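/- Let φ be a propositional CNF formula over a finite set V of variables, each clause being a finite set of literals over V. Over the ground atoms {a_v, a'_v : v ∈ V} ∪ {f₁, f₂}, define the ground program Q(φ) consisting of: for each v ∈ V, the normal rules a_v ← not a'_v and a'_v ← not a_v; for each clause C of φ, the constraint (empty head) with positive body {a_v : the negative literal ¬v is in C} and negative body {a_v : the positive literal v is in C}; and the facts f₁ and f₂. Then: (i) Q(φ) has an answer set if and only if φ is satisfiable (the answer sets of Q(φ) correspond exactly to the satisfying assignments, via v ↦ true iff a_v belongs to the answer set); and (ii) the program Q(φ) ∪ {the constraint with empty head, positive body {f₁, f₂} and empty negative body} has no answer set. -/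

import Mathlib

namespace ASP

/-- A ground rule over a type `A` of ground atoms: finite sets of head,
positive-body, and negative-body atoms. -/
structure GRule (A : Type*) where
  head : Set A
  pos : Set A
  neg : Set A
  head_fin : head.Finite
  pos_fin : pos.Finite
  neg_fin : neg.Finite

/-- An interpretation `I` satisfies a ground rule `r`. -/
def Satisfies {A : Type*} (I : Set A) (r : GRule A) : Prop :=
  (r.pos ⊆ I ∧ r.neg ∩ I = ∅) → (r.head ∩ I).Nonempty

/-- `I` is a model of the ground program `Q`. -/
def IsModel {A : Type*} (I : Set A) (Q : Set (GRule A)) : Prop :=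
  ∀ r ∈ Q, Satisfies I r

/-- The GL reduct of `Q` relative to `S`. -/
def reduct {A : Type*} (Q : Set (GRule A)) (S : Set A) : Set (GRule A) :=
  {r' | ∃ r ∈ Q, r.neg ∩ S = ∅ ∧
    r' = ⟨r.head, r.pos, ∅, r.head_fin, r.pos_fin, Set.finite_empty⟩}

/-- `S` is an answer set of `Q`: a ⊆-minimal model of the reduct `Q^S`. -/
def IsAnswerSet {A : Type*} (Q : Set (GRule A)) (S : Set A) : Prop :=
  IsModel S (reduct Q S) ∧ ∀ T, IsModel T (reduct Q S) → T ⊆ S → T = S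

/-- The set of answer sets of `Q`. -/
def AS {A : Type*} (Q : Set (GRule A)) : Set (Set A) :=
  {S | IsAnswerSet Q S}

/-- All atoms occurring in a ground rule. -/
def ruleAtoms {A : Type*} (r : GRule A) : Set A :=
  r.head ∪ r.pos ∪ r.neg

/-- Ground atoms for the SAT encoding: `a_v`, `a'_v` for each variable `v`,
plus `f₁` and `f₂`. -/
inductive SatAtom (Vr : Type*) where
  | a (v : Vr)      -- the atom `a_v`
  | a' (v : Vr)     -- the atom `a'_v`
  | f1
  | f2

/-- The rule `a_v ← not a'_v`. -/
def choiceRule1 {Vr : Type*} (v : Vr) : GRule (SatAtom Vr) :=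
  ⟨{SatAtom.a v}, ∅, {SatAtom.a' v},
    Set.finite_singleton _, Set.finite_empty, Set.finite_singleton _⟩

/-- The rule `a'_v ← not a_v`. -/
def choiceRule2 {Vr : Type*} (v : Vr) : GRule (SatAtom Vr) :=
  ⟨{SatAtom.a' v}, ∅, {SatAtom.a v},
    Set.finite_singleton _, Set.finite_empty, Set.finite_singleton _⟩

/-- A fact. -/
def factRule {A : Type*} (x : A) : GRule A :=
  ⟨{x}, ∅, ∅, Set.finite_singleton _, Set.finite_empty, Set.finite_empty⟩

/-- A literal over `Vr` is a pair `(v, b)`: `(v, true)` is the positive literal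
`v`, and `(v, false)` is the negative literal `¬v`.  The constraint for a clause
`Cl`: empty head, positive body `{a_v : ¬v ∈ Cl}`, negative body
`{a_v : v ∈ Cl}`. -/
def clauseRule {Vr : Type*} (Cl : Set (Vr × Bool)) (hCl : Cl.Finite) :
    GRule (SatAtom Vr) :=
  ⟨∅, SatAtom.a '' {v | (v, false) ∈ Cl}, SatAtom.a '' {v | (v, true) ∈ Cl},
    Set.finite_empty,
    (((hCl.image Prod.fst).subset (fun v hv => ⟨(v, false), hv, rfl⟩)).image _),
    (((hCl.image Prod.fst).subset (fun v hv => ⟨(v, true), hv, rfl⟩)).image _)⟩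

/-- The ground program `Q(φ)` associated with a CNF formula `φ`. -/
def satProgram {Vr : Type*} (φ : Set (Set (Vr × Bool)))
    (hφ : ∀ Cl ∈ φ, Cl.Finite) : Set (GRule (SatAtom Vr)) :=
  {r | ∃ v, r = choiceRule1 v ∨ r = choiceRule2 v} ∪
  {r | ∃ Cl, ∃ h : Cl ∈ φ, r = clauseRule Cl (hφ Cl h)} ∪
  {factRule SatAtom.f1, factRule SatAtom.f2}

/-- An assignment satisfies a clause iff it makes some literal of the clause true. -/
def SatClause {Vr : Type*} (α : Vr → Bool) (Cl : Set (Vr × Bool)) : Prop :=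
  ∃ l ∈ Cl, α l.1 = l.2

/-- An assignment satisfies a CNF formula iff it satisfies every clause. -/
def SatCNF {Vr : Type*} (α : Vr → Bool) (φ : Set (Set (Vr × Bool))) : Prop :=
  ∀ Cl ∈ φ, SatClause α Cl

/-- The constraint `← f₁, f₂`. -/
def ffConstraint {Vr : Type*} : GRule (SatAtom Vr) :=
  ⟨∅, {SatAtom.f1, SatAtom.f2}, ∅,
    Set.finite_empty, (Set.finite_singleton _).insert _, Set.finite_empty⟩

theorem isModel_reduct_iff {A : Type*} {Q : Set (GRule A)} {S T : Set A} :
    IsModel T (reduct Q S) ↔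
      ∀ r ∈ Q, r.neg ∩ S = ∅ → r.pos ⊆ T → (r.head ∩ T).Nonempty := by
  constructor
  · intro h r hr hneg hpos
    exact h ⟨r.head, r.pos, ∅, r.head_fin, r.pos_fin, Set.finite_empty⟩
      ⟨r, hr, hneg, rfl⟩ ⟨hpos, Set.empty_inter T⟩
  · rintro h _ ⟨r, hr, hneg, rfl⟩ ⟨hpos, -⟩
    exact h r hr hneg hpos

theorem mem_of_factRule_mem {A : Type*} {Q : Set (GRule A)} {S T : Set A} {x : A}
    (hT : IsModel T (reduct Q S)) (hx : factRule x ∈ Q) : x ∈ T := by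
  obtain ⟨y, rfl, hy⟩ :=
    isModel_reduct_iff.1 hT _ hx (Set.empty_inter S) (Set.empty_subset T)
  exact hy

/-- The assignment read off an interpretation. -/
noncomputable def assignmentOf {Vr : Type*} (S : Set (SatAtom Vr)) (v : Vr) : Bool :=
  open Classical in decide (SatAtom.a v ∈ S)

theorem assignmentOf_eq_true {Vr : Type*} {S : Set (SatAtom Vr)} {v : Vr} :
    assignmentOf S v = true ↔ SatAtom.a v ∈ S := by
  simp [assignmentOf]

/-- The interpretation induced by an assignment. -/
def interpretationOf {Vr : Type*} (α : Vr → Bool) : Set (SatAtom Vr)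
  | .a v => α v = true
  | .a' v => α v = false
  | .f1 => True
  | .f2 => True

theorem a_mem_interpretationOf {Vr : Type*} {α : Vr → Bool} {v : Vr} :
    SatAtom.a v ∈ interpretationOf α ↔ α v = true := Iff.rfl

theorem a'_mem_interpretationOf {Vr : Type*} {α : Vr → Bool} {v : Vr} :
    SatAtom.a' v ∈ interpretationOf α ↔ α v = false := Iff.rfl

section

variable {Vr : Type*} {φ : Set (Set (Vr × Bool))} {hφ : ∀ Cl ∈ φ, Cl.Finite}

theorem choiceRule1_mem_satProgram (v : Vr) : choiceRule1 v ∈ satProgram φ hφ :=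
  .inl (.inl ⟨v, .inl rfl⟩)

theorem choiceRule2_mem_satProgram (v : Vr) : choiceRule2 v ∈ satProgram φ hφ :=
  .inl (.inl ⟨v, .inr rfl⟩)

theorem clauseRule_mem_satProgram {Cl : Set (Vr × Bool)} (h : Cl ∈ φ) :
    clauseRule Cl (hφ Cl h) ∈ satProgram φ hφ :=
  .inl (.inr ⟨Cl, h, rfl⟩)

theorem factRule_f1_mem_satProgram : factRule SatAtom.f1 ∈ satProgram φ hφ :=
  .inr (.inl rfl)

theorem factRule_f2_mem_satProgram : factRule SatAtom.f2 ∈ satProgram φ hφ :=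
  .inr (.inr rfl)

theorem satCNF_assignmentOf {S : Set (SatAtom Vr)}
    (hS : IsModel S (reduct (satProgram φ hφ) S)) : SatCNF (assignmentOf S) φ := by
  intro Cl hCl
  by_contra hsat
  have hfalse : ∀ l ∈ Cl, assignmentOf S l.1 ≠ l.2 := fun l hl h => hsat ⟨l, hl, h⟩
  obtain ⟨x, hx, -⟩ := isModel_reduct_iff.1 hS _ (clauseRule_mem_satProgram hCl)
    (by
      rw [Set.eq_empty_iff_forall_notMem]
      rintro _ ⟨⟨v, hv, rfl⟩, hvS⟩
      exact hfalse _ hv (assignmentOf_eq_true.2 hvS))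
    (by
      rintro _ ⟨v, hv, rfl⟩
      exact assignmentOf_eq_true.1 (Bool.eq_true_of_not_eq_false (hfalse _ hv)))
  exact hx

theorem isModel_interpretationOf {α : Vr → Bool} (hα : SatCNF α φ) :
    IsModel (interpretationOf α) (reduct (satProgram φ hφ) (interpretationOf α)) := by
  rw [isModel_reduct_iff]
  rintro r ((⟨v, rfl | rfl⟩ | ⟨Cl, hCl, rfl⟩) | rfl | rfl) hneg hpos
  · refine ⟨_, rfl, a_mem_interpretationOf.2 (Bool.eq_true_of_not_eq_false fun h => ?_)⟩
    exact Set.eq_empty_iff_forall_notMem.1 hneg _ ⟨rfl, a'_mem_interpretationOf.2 h⟩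
  · refine ⟨_, rfl, a'_mem_interpretationOf.2 (Bool.eq_false_of_not_eq_true fun h => ?_)⟩
    exact Set.eq_empty_iff_forall_notMem.1 hneg _ ⟨rfl, a_mem_interpretationOf.2 h⟩
  · obtain ⟨⟨v, b⟩, hl, hv⟩ := hα Cl hCl
    cases b with
    | true =>
      exact (Set.eq_empty_iff_forall_notMem.1 hneg _
        ⟨⟨v, hl, rfl⟩, a_mem_interpretationOf.2 hv⟩).elim
    | false =>
      have hv' := a_mem_interpretationOf.1 (hpos ⟨v, hl, rfl⟩)
      exact absurd (hv.symm.trans hv') Bool.false_ne_true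
  · exact ⟨_, rfl, trivial⟩
  · exact ⟨_, rfl, trivial⟩

theorem interpretationOf_subset {α : Vr → Bool} {T : Set (SatAtom Vr)}
    (hT : IsModel T (reduct (satProgram φ hφ) (interpretationOf α))) :
    interpretationOf α ⊆ T := by
  rintro (v | v | _ | _) hx
  · obtain ⟨_, rfl, h⟩ := isModel_reduct_iff.1 hT _ (choiceRule1_mem_satProgram v)
      (by
        rw [Set.eq_empty_iff_forall_notMem]
        rintro _ ⟨rfl, h⟩
        exact Bool.false_ne_true
          ((a'_mem_interpretationOf.1 h).symm.trans (a_mem_interpretationOf.1 hx)))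
      (Set.empty_subset T)
    exact h
  · obtain ⟨_, rfl, h⟩ := isModel_reduct_iff.1 hT _ (choiceRule2_mem_satProgram v)
      (by
        rw [Set.eq_empty_iff_forall_notMem]
        rintro _ ⟨rfl, h⟩
        exact Bool.false_ne_true
          ((a'_mem_interpretationOf.1 hx).symm.trans (a_mem_interpretationOf.1 h)))
      (Set.empty_subset T)
    exact h
  · exact mem_of_factRule_mem hT factRule_f1_mem_satProgram
  · exact mem_of_factRule_mem hT factRule_f2_mem_satProgram

theorem isAnswerSet_interpretationOf {α : Vr → Bool} (hα : SatCNF α φ) :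
    IsAnswerSet (satProgram φ hφ) (interpretationOf α) :=
  ⟨isModel_interpretationOf hα, fun _ hT hsub => hsub.antisymm (interpretationOf_subset hT)⟩

theorem not_isModel_reduct_ffConstraint {S T : Set (SatAtom Vr)} :
    ¬ IsModel T (reduct (satProgram φ hφ ∪ {ffConstraint}) S) := by
  intro hT
  obtain ⟨x, hx, -⟩ := isModel_reduct_iff.1 hT ffConstraint (.inr rfl) (Set.empty_inter S)
    (by
      rintro _ (rfl | rfl)
      · exact mem_of_factRule_mem hT (.inl factRule_f1_mem_satProgram)
      · exact mem_of_factRule_mem hT (.inl factRule_f2_mem_satProgram))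
  exact hx

end

/-- (i) `Q(φ)` has an answer set iff `φ` is satisfiable, the answer sets of
`Q(φ)` corresponding exactly to the satisfying assignments via
`v ↦ true iff a_v ∈ S`; and (ii) adding the constraint `← f₁, f₂` yields a
program with no answer set. -/
theorem sat_encoding_correct {Vr : Type*} [Finite Vr]
    (φ : Set (Set (Vr × Bool))) (hφfin : φ.Finite)
    (hφ : ∀ Cl ∈ φ, Cl.Finite) :
    ((∃ S, IsAnswerSet (satProgram φ hφ) S) ↔ ∃ α : Vr → Bool, SatCNF α φ) ∧
    (∀ S, IsAnswerSet (satProgram φ hφ) S →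
      ∃ α : Vr → Bool, SatCNF α φ ∧ ∀ v, α v = true ↔ SatAtom.a v ∈ S) ∧
    (∀ α : Vr → Bool, SatCNF α φ →
      ∃ S, IsAnswerSet (satProgram φ hφ) S ∧ ∀ v, α v = true ↔ SatAtom.a v ∈ S) ∧
    ¬ ∃ S, IsAnswerSet (satProgram φ hφ ∪ {ffConstraint}) S := by
  refine ⟨⟨?_, ?_⟩, ?_, ?_, ?_⟩
  · rintro ⟨S, hS⟩
    exact ⟨assignmentOf S, satCNF_assignmentOf hS.1⟩
  · rintro ⟨α, hα⟩
    exact ⟨interpretationOf α, isAnswerSet_interpretationOf hα⟩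
  · intro S hS
    exact ⟨assignmentOf S, satCNF_assignmentOf hS.1, fun _ => assignmentOf_eq_true⟩
  · intro α hα
    exact ⟨interpretationOf α, isAnswerSet_interpretationOf hα,
      fun _ => a_mem_interpretationOf.symm⟩
  · rintro ⟨S, hS⟩
    exact not_isModel_reduct_ffConstraint hS.1

end ASP
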